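/- Let Ω ⊂ ℝ³ be a connected open set containing 0, with λ, μ, ρ, t_jk ∈ C^∞(Ω), ρ > 0, T = (t_jk) symmetric with ∇·T = 0, and the operators P₁ = Σ(μδ_jk + t_jk)∂²_{jk}, P₂ = Σ((λ+2μ)δ_jk + t_jk)∂²_{jk} uniformly elliptic. Let u : Ω → ℝ³ be a smooth solution of the residual stress system ∇·σ + κ²ρu = 0 such that for every N > 0, ∫_{R ≤ |x| ≤ 2R} |u|² dx = O(R^N) as R → 0, and set U = (u, ∇·u, ∇×u) : Ω → ℝ⁷. Then for every multiindex β with |β| ≤ 1 and every N > 0, ∫_{R ≤ |x| ≤ 2R} |∂^β U|² dx = O(R^N) as R → 0. -/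

import Mathlib

open MeasureTheory Metric Finset

noncomputable section

/-- `ℝ³` with the Euclidean norm. -/
abbrev E3 := EuclideanSpace ℝ (Fin 3)
/-- `ℝ⁷` with the Euclidean norm. -/
abbrev E7 := EuclideanSpace ℝ (Fin 7)

/-- The partial derivative `∂_i f`. -/
def pd (i : Fin 3) (f : E3 → ℝ) : E3 → ℝ :=
  fun x => fderiv ℝ f x (EuclideanSpace.single i 1)

/-- The multiindex partial derivative `∂^β f`. -/
def mpd (β : Fin 3 → ℕ) (f : E3 → ℝ) : E3 → ℝ :=
  (pd 0)^[β 0] ((pd 1)^[β 1] ((pd 2)^[β 2] f))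

/-- The length `|β|` of a multiindex. -/
def mdeg (β : Fin 3 → ℕ) : ℕ := β 0 + β 1 + β 2

/-- `f` belongs to the Gevrey class `G^s(Ω)`. -/
def GevreyOn (s : ℝ) (Ω : Set E3) (f : E3 → ℝ) : Prop :=
  ContDiffOn ℝ (⊤ : ℕ∞) f Ω ∧ ∃ c > 0, ∃ A > 0, ∀ β : Fin 3 → ℕ, ∀ x ∈ Ω,
    |mpd β f x| ≤ c * A ^ mdeg β * (Nat.factorial (mdeg β) : ℝ) ^ s

/-- The second-order operator `Σ_{j,k} a_jk(x) ∂²_{jk}` applied to a scalar function. -/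
def op2 (a : Fin 3 → Fin 3 → E3 → ℝ) (f : E3 → ℝ) : E3 → ℝ :=
  fun x => ∑ j, ∑ k, a j k x * pd j (pd k f) x

/-- Uniform (strong) ellipticity of `Σ_{j,k} a_jk(x) ∂²_{jk}` on `Ω`. -/
def UnifElliptic (a : Fin 3 → Fin 3 → E3 → ℝ) (Ω : Set E3) : Prop :=
  ∃ c0 > 0, ∀ x ∈ Ω, ∀ ξ : Fin 3 → ℝ,
    c0 * (∑ i, ξ i ^ 2) ≤ ∑ j, ∑ k, a j k x * ξ j * ξ k

/-- The coefficient matrix of the operator at a point. -/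
def coefMatrix (a : Fin 3 → Fin 3 → E3 → ℝ) (x : E3) : Matrix (Fin 3) (Fin 3) ℝ :=
  Matrix.of fun j k => a j k x

/-- `α > (λ₃ - λ₁)/λ₁` where `λ₁ ≤ λ₂ ≤ λ₃` are the eigenvalues of the coefficient
matrix at `0`: equivalently (the eigenvalues being positive), for any pair of
eigenvalues the corresponding ratio is `< α`. -/
def EigCond (a : Fin 3 → Fin 3 → E3 → ℝ) (α : ℝ) : Prop :=
  ∀ h : (coefMatrix a 0).IsHermitian, ∀ i j : Fin 3,
    (h.eigenvalues i - h.eigenvalues j) / h.eigenvalues j < α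

/-- The coefficients `a¹_jk = μ δ_jk + t_jk` of `P₁`. -/
def a1coef (t : Fin 3 → Fin 3 → E3 → ℝ) (mu : E3 → ℝ) : Fin 3 → Fin 3 → E3 → ℝ :=
  fun j k x => mu x * (if j = k then 1 else 0) + t j k x

/-- The coefficients `a²_jk = (λ + 2μ) δ_jk + t_jk` of `P₂`. -/
def a2coef (t : Fin 3 → Fin 3 → E3 → ℝ) (lam mu : E3 → ℝ) : Fin 3 → Fin 3 → E3 → ℝ :=
  fun j k x => (lam x + 2 * mu x) * (if j = k then 1 else 0) + t j k x

/-- The divergence `∇·u`. -/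
def divg (u : E3 → Fin 3 → ℝ) (x : E3) : ℝ := ∑ i, pd i (fun y => u y i) x

/-- The curl `∇×u`. -/
def curl (u : E3 → Fin 3 → ℝ) (x : E3) : Fin 3 → ℝ :=
  ![pd 1 (fun y => u y 2) x - pd 2 (fun y => u y 1) x,
    pd 2 (fun y => u y 0) x - pd 0 (fun y => u y 2) x,
    pd 0 (fun y => u y 1) x - pd 1 (fun y => u y 0) x]

/-- The infinitesimal strain `E = (∇u + (∇u)ᵗ)/2`. -/
def strain (u : E3 → Fin 3 → ℝ) (x : E3) (i j : Fin 3) : ℝ :=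
  (pd j (fun y => u y i) x + pd i (fun y => u y j) x) / 2

/-- The stress tensor `σ = T + (∇u)T + λ(tr E)I + 2μE`. -/
def stress (t : Fin 3 → Fin 3 → E3 → ℝ) (lam mu : E3 → ℝ) (u : E3 → Fin 3 → ℝ)
    (x : E3) (i j : Fin 3) : ℝ :=
  t i j x + (∑ k, pd k (fun y => u y i) x * t k j x)
    + lam x * divg u x * (if i = j then 1 else 0)
    + 2 * mu x * strain u x i j

/-- The residual stress system `∇·σ + κ²ρu = 0` on `Ω`. -/
def ResSystem (t : Fin 3 → Fin 3 → E3 → ℝ) (lam mu rho : E3 → ℝ) (κ : ℝ)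
    (u : E3 → Fin 3 → ℝ) (Ω : Set E3) : Prop :=
  ∀ x ∈ Ω, ∀ i : Fin 3,
    (∑ j, pd j (fun y => stress t lam mu u y i j) x) + κ ^ 2 * rho x * u x i = 0

/-- The vector `U = (u, ∇·u, ∇×u) : Ω → ℝ⁷`. -/
def Ufull (u : E3 → Fin 3 → ℝ) : E3 → Fin 7 → ℝ :=
  fun x => ![u x 0, u x 1, u x 2, divg u x, curl u x 0, curl u x 1, curl u x 2]

/-- The lower-order term `Σ_{|β|≤3} a_β ∂^β U`, component `i`. -/
def lowOrd (aβ : (Fin 3 → ℕ) → E3 → Fin 7 → Fin 7 → ℝ) (U : E3 → Fin 7 → ℝ)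
    (x : E3) (i : Fin 7) : ℝ :=
  ∑ β ∈ Finset.univ.filter (fun β : Fin 3 → Fin 4 => mdeg (fun k => (β k : ℕ)) ≤ 3),
    ∑ j, aβ (fun k => (β k : ℕ)) x i j * mpd (fun k => (β k : ℕ)) (fun y => U y j) x

/-- `f` vanishes to infinite order at `0`. -/
def FlatAtZero (f : E3 → ℝ) : Prop :=
  ∀ n : ℕ, f =O[nhdsWithin 0 {0}ᶜ] fun x => ‖x‖ ^ n

/-- `f` is smooth near `0` and vanishes to infinite order there. -/
def SmoothFlatAtZero (f : E3 → ℝ) : Prop :=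
  ContDiffAt ℝ (⊤ : ℕ∞) f 0 ∧ FlatAtZero f

lemma SmoothFlatAtZero.add {f g : E3 → ℝ} (hf : SmoothFlatAtZero f) (hg : SmoothFlatAtZero g) :
    SmoothFlatAtZero (fun x => f x + g x) :=
  ⟨hf.1.add hg.1, fun n => (hf.2 n).add (hg.2 n)⟩

lemma SmoothFlatAtZero.sub {f g : E3 → ℝ} (hf : SmoothFlatAtZero f) (hg : SmoothFlatAtZero g) :
    SmoothFlatAtZero (fun x => f x - g x) :=
  ⟨hf.1.sub hg.1, fun n => (hf.2 n).sub (hg.2 n)⟩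

lemma ContDiffAt.pd {f : E3 → ℝ} {x : E3} (hf : ContDiffAt ℝ (⊤ : ℕ∞) f x) (i : Fin 3) :
    ContDiffAt ℝ (⊤ : ℕ∞) (pd i f) x :=
  (hf.fderiv_right (m := (⊤ : ℕ∞)) (by simp)).clm_apply contDiffAt_const

/-- First-order Taylor expansion with a locally uniform quadratic remainder. -/
lemma ContDiffAt.exists_quadratic_remainder {f : E3 → ℝ} (hf : ContDiffAt ℝ (⊤ : ℕ∞) f 0) :
    ∃ L > 0, ∃ δ > 0, ∀ x ∈ ball (0 : E3) δ, ∀ y ∈ ball (0 : E3) δ,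
      |f y - f x - fderiv ℝ f x (y - x)| ≤ L * ‖y - x‖ ^ 2 := by
  have hf' : ContDiffAt ℝ 1 (fderiv ℝ f) 0 :=
    hf.fderiv_right (m := 1) (by norm_cast)
  obtain ⟨K, s, hs, hK⟩ := hf'.exists_lipschitzOnWith
  have hd : ∀ᶠ x in nhds (0 : E3), DifferentiableAt ℝ f x :=
    ((hf.of_le (m := 1) (by norm_cast)).eventually (by simp)).mono
      fun x hx => hx.differentiableAt one_ne_zero
  obtain ⟨δ, hδ, hball⟩ := Metric.mem_nhds_iff.1 (Filter.inter_mem hs hd)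
  refine ⟨K + 1, by positivity, δ, hδ, fun x hx y hy => ?_⟩
  have hconv : Convex ℝ (ball (0 : E3) δ ∩ closedBall x ‖y - x‖) :=
    (convex_ball _ _).inter (convex_closedBall _ _)
  have key := hconv.norm_image_sub_le_of_norm_hasFDerivWithin_le' (f := f) (f' := fderiv ℝ f)
    (φ := fderiv ℝ f x) (C := (K + 1) * ‖y - x‖) (x := x) (y := y)
    (fun z hz => (hball hz.1).2.hasFDerivAt.hasFDerivWithinAt)
    (fun z hz => by
      have h1 := hK.dist_le_mul z (hball hz.1).1 x (hball hx).1
      rw [dist_eq_norm] at h1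
      have h2 : Dist.dist z x ≤ ‖y - x‖ := hz.2
      have h3 : (0 : ℝ) ≤ K := K.2
      nlinarith [norm_nonneg (y - x)])
    ⟨hx, by simp⟩ ⟨hy, by simp [dist_eq_norm]⟩
  rw [Real.norm_eq_abs] at key
  linarith [key, sq ‖y - x‖]

lemma SmoothFlatAtZero.pd {f : E3 → ℝ} (hf : SmoothFlatAtZero f) (i : Fin 3) :
    SmoothFlatAtZero (pd i f) := by
  refine ⟨hf.1.pd i, fun n => ?_⟩
  obtain ⟨L, hL, δ, hδ, hrem⟩ := hf.1.exists_quadratic_remainder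
  obtain ⟨C, hC, hbound⟩ := (hf.2 (2 * (n + 2))).exists_pos
  rw [Asymptotics.isBigOWith_iff, eventually_nhdsWithin_iff, Metric.eventually_nhds_iff] at hbound
  obtain ⟨ε, hε, hb⟩ := hbound
  rw [Asymptotics.isBigO_iff]
  refine ⟨C * 2 ^ (2 * (n + 2)) + C + L, ?_⟩
  rw [eventually_nhdsWithin_iff, Metric.eventually_nhds_iff]
  refine ⟨min (1 / 2) (min (δ / 2) (ε / 2)), by positivity, fun x hx hx0 => ?_⟩
  have hx0 : x ≠ 0 := hx0
  rw [dist_zero_right, lt_min_iff, lt_min_iff] at hx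
  obtain ⟨hx1, hxδ, hxε⟩ := hx
  have hr : 0 < ‖x‖ := norm_pos_iff.2 hx0
  set r := ‖x‖ with hrdef
  set h := r ^ (n + 2) with hh
  have hhpos : 0 < h := by positivity
  have hhr : h ≤ r / 2 := by
    have : h = r ^ (n + 1) * r := by rw [hh]; ring
    have h2 : r ^ (n + 1) ≤ r := by
      simpa using pow_le_pow_of_le_one hr.le (by linarith) (show 1 ≤ n + 1 by omega)
    nlinarith
  have hhn : h ≤ r ^ n := pow_le_pow_of_le_one hr.le (by linarith) (by omega)
  set y : E3 := x + h • EuclideanSpace.single i (1 : ℝ) with hy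
  have hyx : y - x = h • EuclideanSpace.single i (1 : ℝ) := by simp [hy]
  have hnyx : ‖y - x‖ = h := by rw [hyx, norm_smul]; simp [abs_of_pos hhpos]
  have hy_le : ‖y‖ ≤ 2 * r := by
    have := norm_add_le x (y - x)
    rw [add_sub_cancel, hnyx] at this
    linarith
  have hy0 : y ≠ 0 := by
    intro h0
    rw [h0, zero_sub, norm_neg] at hnyx
    linarith
  have hfx := hb (y := x) (by rw [dist_zero_right]; linarith) hx0
  have hfy := hb (y := y) (by rw [dist_zero_right]; linarith) hy0
  rw [norm_pow, norm_norm, Real.norm_eq_abs] at hfx hfy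
  have hfy' : |f y| ≤ C * 2 ^ (2 * (n + 2)) * (h * h) := by
    have : ‖y‖ ^ (2 * (n + 2)) ≤ (2 * r) ^ (2 * (n + 2)) := by gcongr
    calc |f y| ≤ C * (2 * r) ^ (2 * (n + 2)) := hfy.trans (by gcongr)
      _ = _ := by rw [hh, mul_pow, ← pow_add]; ring
  have hfx' : |f x| ≤ C * (h * h) := by
    calc |f x| ≤ C * r ^ (2 * (n + 2)) := hfx
      _ = _ := by rw [hh, ← pow_add]; ring
  have hq := hrem x (by rw [mem_ball_zero_iff]; linarith) y (by rw [mem_ball_zero_iff]; linarith)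
  rw [hnyx, hyx, map_smul, smul_eq_mul] at hq
  change |f y - f x - h * _root_.pd i f x| ≤ _ at hq
  rw [norm_pow, norm_norm, Real.norm_eq_abs]
  have habs : h * |_root_.pd i f x| ≤ h * ((C * 2 ^ (2 * (n + 2)) + C + L) * h) := by
    rw [← abs_of_pos hhpos, ← abs_mul, abs_of_pos hhpos, abs_le]
    have h1 := abs_le.1 hq
    have h2 := abs_le.1 hfx'
    have h3 := abs_le.1 hfy'
    constructor <;> linarith [h1.1, h1.2, h2.1, h2.2, h3.1, h3.2]
  calc |_root_.pd i f x| ≤ (C * 2 ^ (2 * (n + 2)) + C + L) * h := le_of_mul_le_mul_left habs hhpos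
    _ ≤ _ := by gcongr

lemma SmoothFlatAtZero.mpd {f : E3 → ℝ} (hf : SmoothFlatAtZero f) (β : Fin 3 → ℕ) :
    SmoothFlatAtZero (mpd β f) := by
  have iter : ∀ (i : Fin 3) (k : ℕ) (g : E3 → ℝ), SmoothFlatAtZero g →
      SmoothFlatAtZero ((_root_.pd i)^[k] g) := by
    intro i k
    induction k with
    | zero => exact fun g hg => hg
    | succ k ih => exact fun g hg => ih _ (hg.pd i)
  exact iter 0 _ _ (iter 1 _ _ (iter 2 _ _ hf))

lemma isCompact_annulus (a b : ℝ) : IsCompact {y : E3 | a ≤ ‖y‖ ∧ ‖y‖ ≤ b} := by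
  refine (isCompact_closedBall (0 : E3) b).of_isClosed_subset ?_ fun y hy => by simpa using hy.2
  exact (isClosed_le continuous_const continuous_norm).inter
    (isClosed_le continuous_norm continuous_const)

/-- A Lipschitz function dominated by a function with rapidly decaying annulus integrals
vanishes to infinite order pointwise. -/
lemma flatAtZero_of_setIntegral_annulus {f F : E3 → ℝ} {K : NNReal} {δ₀ : ℝ} (hδ₀ : 0 < δ₀)
    (hf : LipschitzOnWith K f (ball 0 δ₀)) (hF : ContinuousOn F (ball 0 δ₀))
    (hF0 : ∀ x, 0 ≤ F x) (hfF : ∀ x, f x ^ 2 ≤ F x)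
    (hflat : ∀ N : ℝ, 0 < N → ∃ C > 0, ∃ δ > 0, ∀ R : ℝ, 0 < R → R < δ →
      (∫ x in {y : E3 | R ≤ ‖y‖ ∧ ‖y‖ ≤ 2 * R}, F x) ≤ C * R ^ N) :
    FlatAtZero f := by
  intro n
  set L : ℝ := K + 1 with hLdef
  have hL : 1 ≤ L := by simp [hLdef]
  set m := n + 1 with hm
  obtain ⟨C, hC, δ, hδ, hint⟩ := hflat ((5 * m + 1 : ℕ) : ℝ) (by positivity)
  set V : ℝ := volume.real (ball (0 : E3) 1) with hV
  have hVpos : 0 < V := ENNReal.toReal_pos (measure_ball_pos _ _ one_pos).ne' measure_ball_lt_top.ne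
  rw [Asymptotics.isBigO_iff]
  refine ⟨1, ?_⟩
  rw [eventually_nhdsWithin_iff, Metric.eventually_nhds_iff]
  refine ⟨min 1 (min (δ₀ / 2) (min δ (V / (256 * L ^ 3) / C))), by positivity, fun x hx hx0 => ?_⟩
  have hr : 0 < ‖x‖ := norm_pos_iff.2 hx0
  rw [dist_zero_right, lt_min_iff, lt_min_iff, lt_min_iff] at hx
  rw [norm_pow, norm_norm, Real.norm_eq_abs, one_mul]
  set r := ‖x‖ with hrdef
  obtain ⟨hr1, hrδ₀, hrδ, hrC⟩ := hx
  have hmn : r ^ m ≤ r ^ n := pow_le_pow_of_le_one hr.le hr1.le (by omega)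
  by_contra! hcon
  have hcon : r ^ m < |f x| := hmn.trans_lt hcon
  set s := r ^ m / (4 * L) with hs
  have hrm : r ^ m ≤ r := by
    simpa using pow_le_pow_of_le_one hr.le hr1.le (show 1 ≤ m by omega)
  have hspos : 0 < s := by positivity
  have hLs : L * s = r ^ m / 4 := by rw [hs]; field_simp
  have hsr : s ≤ r / 4 := by nlinarith
  set R := 2 / 3 * r with hR
  set A := {y : E3 | R ≤ ‖y‖ ∧ ‖y‖ ≤ 2 * R} with hA
  have hsub : closedBall x s ⊆ A := by
    intro y hy
    rw [mem_closedBall, dist_eq_norm] at hy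
    have h1 := norm_le_norm_add_norm_sub' y x
    have h2 := norm_le_norm_add_norm_sub' x y
    rw [norm_sub_rev] at h2
    constructor <;> linarith
  have hAball : A ⊆ ball 0 δ₀ := fun y hy => by
    rw [mem_ball_zero_iff]; linarith [hy.2]
  have hFint : IntegrableOn F A :=
    (hF.mono hAball).integrableOn_compact (isCompact_annulus _ _)
  have hlow : ∀ y ∈ closedBall x s, (r ^ m / 2) ^ 2 ≤ F y := by
    intro y hy
    refine le_trans ?_ (hfF y)
    have h1 := hf.dist_le_mul x (by rw [mem_ball_zero_iff]; linarith) y (hAball (hsub hy))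
    rw [Real.dist_eq] at h1
    have h2 : dist x y ≤ s := by rw [dist_comm]; exact hy
    have h3 : |f x - f y| ≤ r ^ m / 4 := by
      rw [← hLs]
      refine h1.trans ?_
      have : (0 : ℝ) ≤ K := K.2
      nlinarith [dist_nonneg (x := x) (y := y)]
    have h4 := abs_sub_abs_le_abs_sub (f x) (f y)
    rw [← sq_abs (f y)]
    gcongr
    linarith [pow_pos hr m]
  have hge : (r ^ m / 2) ^ 2 * (s ^ 3 * V) ≤ ∫ y in A, F y := by
    calc (r ^ m / 2) ^ 2 * (s ^ 3 * V)
        = (r ^ m / 2) ^ 2 * volume.real (closedBall x s) := by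
          rw [Measure.addHaar_real_closedBall _ _ hspos.le]; simp [hV]
      _ ≤ ∫ y in closedBall x s, F y :=
          setIntegral_ge_of_const_le_real measurableSet_closedBall
            measure_closedBall_lt_top.ne hlow (hFint.mono_set hsub)
      _ ≤ ∫ y in A, F y :=
          setIntegral_mono_set hFint (Filter.Eventually.of_forall hF0) hsub.eventuallyLE
  have hle := hge.trans (hint R (by positivity) (by linarith))
  rw [Real.rpow_natCast] at hle
  have hRr : R ^ (5 * m + 1) ≤ r ^ (5 * m + 1) := by
    have : R ≤ r := by linarith
    gcongr
  have hfin : r ^ (5 * m) * (V / (256 * L ^ 3)) ≤ r ^ (5 * m) * (C * r) := by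
    calc r ^ (5 * m) * (V / (256 * L ^ 3)) = (r ^ m / 2) ^ 2 * (s ^ 3 * V) := by
          rw [hs, mul_comm 5 m, pow_mul]; field_simp; norm_num
      _ ≤ C * R ^ (5 * m + 1) := hle
      _ ≤ C * r ^ (5 * m + 1) := by gcongr
      _ = _ := by ring
  have := le_of_mul_le_mul_left hfin (by positivity)
  rw [lt_div_iff₀ hC] at hrC
  linarith

/-- Annulus integrals of squares of functions vanishing to infinite order decay rapidly. -/
lemma setIntegral_annulus_le_of_flatAtZero {ι : Type*} [Fintype ι] {f : ι → E3 → ℝ}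
    (hf : ∀ i, FlatAtZero (f i)) (N : ℝ) :
    ∃ C > 0, ∃ δ > 0, ∀ R : ℝ, 0 < R → R < δ →
      (∫ x in {y : E3 | R ≤ ‖y‖ ∧ ‖y‖ ≤ 2 * R}, ∑ i, f i x ^ 2) ≤ C * R ^ N := by
  set n := ⌈N⌉₊
  have hsum : (fun x => ∑ i, f i x ^ 2) =O[nhdsWithin 0 {0}ᶜ] fun x => ‖x‖ ^ n := by
    refine Asymptotics.IsBigO.fun_sum fun i _ => ?_
    simpa [sq] using (hf i n).mul (hf i 0)
  obtain ⟨C, hC, hb⟩ := hsum.exists_pos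
  rw [Asymptotics.isBigOWith_iff, eventually_nhdsWithin_iff, Metric.eventually_nhds_iff] at hb
  obtain ⟨ε, hε, hb⟩ := hb
  set V : ℝ := volume.real (closedBall (0 : E3) 2) with hV
  refine ⟨C * 2 ^ n * (V + 1), by positivity, min 1 (ε / 2), by positivity, fun R hR hRδ => ?_⟩
  rw [lt_min_iff] at hRδ
  have hsub : {y : E3 | R ≤ ‖y‖ ∧ ‖y‖ ≤ 2 * R} ⊆ closedBall 0 2 := fun y hy => by
    rw [mem_closedBall_zero_iff]; linarith [hy.2]
  have hvol : volume.real {y : E3 | R ≤ ‖y‖ ∧ ‖y‖ ≤ 2 * R} ≤ V :=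
    measureReal_mono hsub measure_closedBall_lt_top.ne
  have hle := norm_setIntegral_le_of_norm_le_const (μ := volume)
    (f := fun x => ∑ i, f i x ^ 2) (C := C * (2 * R) ^ n)
    (isCompact_annulus R (2 * R)).measure_lt_top (fun x hx => by
      have hx0 : x ≠ 0 := norm_ne_zero_iff.1 (hR.trans_le hx.1).ne'
      refine (hb (by rw [dist_zero_right]; linarith [hx.2]) hx0).trans ?_
      rw [norm_pow, norm_norm]
      have := hx.2
      gcongr)
  have hpow : R ^ n ≤ R ^ N := by
    rw [← Real.rpow_natCast]
    exact Real.rpow_le_rpow_of_exponent_ge hR hRδ.1.le (Nat.le_ceil N)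
  calc _ ≤ C * (2 * R) ^ n * volume.real {y : E3 | R ≤ ‖y‖ ∧ ‖y‖ ≤ 2 * R} :=
        (Real.le_norm_self _).trans hle
    _ ≤ C * (2 * R) ^ n * (V + 1) := by gcongr; linarith
    _ = C * 2 ^ n * (V + 1) * R ^ n := by rw [mul_pow]; ring
    _ ≤ _ := by gcongr

lemma SmoothFlatAtZero.ufull {u : E3 → Fin 3 → ℝ}
    (hu : ∀ i, SmoothFlatAtZero (fun x => u x i)) (i : Fin 7) :
    SmoothFlatAtZero (fun x => Ufull u x i) := by
  have hd : SmoothFlatAtZero (divg u) := by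
    have := (((hu 0).pd 0).add ((hu 1).pd 1)).add ((hu 2).pd 2)
    convert this using 2
    exact Fin.sum_univ_three _
  fin_cases i
  · exact hu 0
  · exact hu 1
  · exact hu 2
  · exact hd
  · exact ((hu 2).pd 1).sub ((hu 1).pd 2)
  · exact ((hu 0).pd 2).sub ((hu 2).pd 0)
  · exact ((hu 1).pd 0).sub ((hu 0).pd 1)

/-- **Flatness of `U = (u, ∇·u, ∇×u)`** (Corollary 3.2).  If `u` is a smooth
solution of the residual stress system vanishing to infinite order at `0` in the
`L²` annulus sense, then `∫_{R≤|x|≤2R}|∂^β U|² = O(R^N)` as `R → 0` for every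
`|β| ≤ 1` and every `N > 0`. -/
theorem flatness_of_U
    (Ω : Set E3) (hΩopen : IsOpen Ω) (hΩconn : IsConnected Ω) (h0Ω : (0 : E3) ∈ Ω)
    (κ : ℝ) (t : Fin 3 → Fin 3 → E3 → ℝ) (lam mu rho : E3 → ℝ)
    (htsym : ∀ j k : Fin 3, ∀ x ∈ Ω, t j k x = t k j x)
    (hdivT : ∀ x ∈ Ω, ∀ i : Fin 3, (∑ j, pd j (t i j) x) = 0)
    (hrho : ∀ x ∈ Ω, 0 < rho x)
    (hsmooth : (∀ j k : Fin 3, ContDiffOn ℝ (⊤ : ℕ∞) (t j k) Ω) ∧ ContDiffOn ℝ (⊤ : ℕ∞) lam Ω ∧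
      ContDiffOn ℝ (⊤ : ℕ∞) mu Ω ∧ ContDiffOn ℝ (⊤ : ℕ∞) rho Ω)
    (hell1 : UnifElliptic (a1coef t mu) Ω) (hell2 : UnifElliptic (a2coef t lam mu) Ω)
    (u : E3 → Fin 3 → ℝ) (hu : ∀ i : Fin 3, ContDiffOn ℝ (⊤ : ℕ∞) (fun x => u x i) Ω)
    (hsol : ResSystem t lam mu rho κ u Ω)
    (hflat : ∀ N : ℝ, 0 < N → ∃ C > 0, ∃ δ > 0, ∀ R : ℝ, 0 < R → R < δ →
      (∫ x in {y : E3 | R ≤ ‖y‖ ∧ ‖y‖ ≤ 2 * R}, ∑ i, (u x i) ^ 2) ≤ C * R ^ N) :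
    ∀ β : Fin 3 → ℕ, mdeg β ≤ 1 → ∀ N : ℝ, 0 < N → ∃ C > 0, ∃ δ > 0,
      ∀ R : ℝ, 0 < R → R < δ →
        (∫ x in {y : E3 | R ≤ ‖y‖ ∧ ‖y‖ ≤ 2 * R},
            ∑ i, (mpd β (fun y => Ufull u y i) x) ^ 2) ≤ C * R ^ N := by
  intro β _ N _
  have hΩ : Ω ∈ nhds (0 : E3) := hΩopen.mem_nhds h0Ω
  have hsm : ∀ i, ContDiffAt ℝ (⊤ : ℕ∞) (fun x => u x i) 0 := fun i => (hu i).contDiffAt hΩ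
  have hu0 : ∀ i, SmoothFlatAtZero (fun x => u x i) := by
    intro i
    refine ⟨hsm i, ?_⟩
    obtain ⟨K, s, hs, hK⟩ :=
      ((hsm i).of_le (m := 1) (by norm_cast)).exists_lipschitzOnWith
    obtain ⟨δ, hδ, hball⟩ := Metric.mem_nhds_iff.1 (Filter.inter_mem hs hΩ)
    refine flatAtZero_of_setIntegral_annulus (F := fun x => ∑ i, u x i ^ 2) hδ
      (hK.mono fun x hx => (hball hx).1) ?_ (fun x => by positivity) (fun x => ?_) hflat
    · exact continuousOn_finsetSum _ fun j _ =>
        ((hu j).continuousOn.mono fun x hx => (hball hx).2).pow 2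
    · exact Finset.single_le_sum (f := fun j => u x j ^ 2) (fun j _ => sq_nonneg _)
        (Finset.mem_univ i)
  exact setIntegral_annulus_le_of_flatAtZero
    (fun i => ((SmoothFlatAtZero.ufull hu0 i).mpd β).2) N
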